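/- Let λ be a real eigenvalue of M with |λ| > 1 and let u ∈ ℝ⁴ be a nonzero left eigenvector of M for λ (uᵀM = λuᵀ). Then there exists a constant C such that for all factors b₀ = w[p,q) and c₀ = w[p',q') of w with the same length and the same sum of letters, and all i ∈ ℕ, the ancestral blocks b_i := w[par^i(p), par^i(q)) and c_i := w[par^i(p'), par^i(q')) satisfy |u·(ψ(b_i) − ψ(c_i))| ≤ C. -/

import Mathlib

/-- The morphism φ on letters: φ(0)=03, φ(1)=43, φ(3)=1, φ(4)=01. -/
def phiLetter : ℕ → List ℕ
  | 0 => [0, 3]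
  | 1 => [4, 3]
  | 3 => [1]
  | 4 => [0, 1]
  | _ => []

/-- The morphism φ on words, applied letterwise and concatenated. -/
def phi (x : List ℕ) : List ℕ := x.flatMap phiLetter

/-- The fixed point `w` of φ beginning with 0: `w n` is the `n`-th letter of
`φ^k([0])` for any `k` with `|φ^k([0])| > n` (e.g. `k = n+1`). -/
def w (n : ℕ) : ℕ := (phi^[n + 1] [0]).getD n 0

/-- The factor `w[p, q) = (w p, …, w (q-1))`. -/
def factorW (p q : ℕ) : List ℕ := (List.range' p (q - p)).map w

/-- The Parikh map ψ, sending a word over `{0,1,3,4}` to `(|x|₀,|x|₁,|x|₃,|x|₄) ∈ ℤ⁴`. -/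
def psi (x : List ℕ) : Fin 4 → ℤ :=
  ![(x.count 0 : ℤ), (x.count 1 : ℤ), (x.count 3 : ℤ), (x.count 4 : ℤ)]

/-- The incidence matrix of φ. -/
def M : Matrix (Fin 4) (Fin 4) ℤ :=
  !![1, 0, 0, 1; 0, 0, 1, 1; 1, 1, 0, 0; 0, 1, 0, 0]

/-- `η(p) = |φ(w[0,p))|`. -/
def eta (p : ℕ) : ℕ := (phi ((List.range p).map w)).length

/-- `σ(p) = ψ(w[0,p))`, the Parikh vector of the prefix of `w` of length `p`. -/
def sigmaW (p : ℕ) : Fin 4 → ℤ := psi ((List.range p).map w)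

/-- The parent of a position `x`: the unique `t` with `η(t) ≤ x < η(t+1)`. -/
def par (x : ℕ) : ℕ := Nat.findGreatest (fun t => eta t ≤ x) x

/-- Membership in the alphabet. -/
def InSig (n : ℕ) : Prop := n = 0 ∨ n = 1 ∨ n = 3 ∨ n = 4

lemma phi_append (x y : List ℕ) : phi (x ++ y) = phi x ++ phi y := by
  simp [phi]

lemma phi_cons (a : ℕ) (y : List ℕ) : phi (a :: y) = phiLetter a ++ phi y := by
  simp [phi]

lemma phi_prefix {x y : List ℕ} (h : x <+: y) : phi x <+: phi y := by
  obtain ⟨t, rfl⟩ := h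
  rw [phi_append]; exact List.prefix_append _ _

lemma phi_insig {x : List ℕ} (h : ∀ a ∈ x, InSig a) : ∀ a ∈ phi x, InSig a := by
  intro a ha
  simp only [phi, List.mem_flatMap] at ha
  obtain ⟨b, hb, hab⟩ := ha
  rcases h b hb with rfl | rfl | rfl | rfl <;> simp [phiLetter] at hab <;> unfold InSig <;> omega

lemma phi_length_ge {x : List ℕ} (h : ∀ a ∈ x, InSig a) : x.length ≤ (phi x).length := by
  induction x with
  | nil => simp
  | cons a x ih =>
    rw [phi_cons]
    have h1 := ih (fun b hb => h b (by simp [hb]))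
    have h2 : 1 ≤ (phiLetter a).length := by
      rcases h a (by simp) with rfl | rfl | rfl | rfl <;> simp [phiLetter]
    simp; omega

/-- The iterates. -/
def itw (k : ℕ) : List ℕ := phi^[k] [0]

lemma itw_succ (k : ℕ) : itw (k + 1) = phi (itw k) := by
  simp [itw, Function.iterate_succ_apply']

lemma itw_insig (k : ℕ) : ∀ a ∈ itw k, InSig a := by
  induction k with
  | zero => simp [itw, InSig]
  | succ k ih => rw [itw_succ]; exact phi_insig ih

lemma itw_form (k : ℕ) : ∃ y, itw k = 0 :: y ∧ k ≤ y.length := by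
  induction k with
  | zero => exact ⟨[], by simp [itw]⟩
  | succ k ih =>
    obtain ⟨y, hy, hl⟩ := ih
    refine ⟨3 :: phi y, ?_, ?_⟩
    · rw [itw_succ, hy, phi_cons]; rfl
    · have := phi_length_ge (x := y) (fun a ha => itw_insig k a (by rw [hy]; simp [ha]))
      simp; omega

lemma itw_length (k : ℕ) : k < (itw k).length := by
  obtain ⟨y, hy, hl⟩ := itw_form k
  rw [hy]; simp; omega

lemma itw_prefix_succ (k : ℕ) : itw k <+: itw (k + 1) := by
  induction k with
  | zero => exact ⟨[3], by simp [itw, phi, phiLetter]⟩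
  | succ k ih => rw [itw_succ, itw_succ (k+1)]; exact phi_prefix ih

lemma itw_prefix {k l : ℕ} (h : k ≤ l) : itw k <+: itw l := by
  induction l, h using Nat.le_induction with
  | base => exact List.prefix_refl _
  | succ l _ ih => exact ih.trans (itw_prefix_succ l)

lemma w_eq {k n : ℕ} (h : n < (itw k).length) : w n = (itw k)[n] := by
  have h1 : n < (itw (n+1)).length := by have := itw_length (n+1); omega
  have h0 : w n = (itw (n+1))[n] := by
    change (itw (n+1)).getD n 0 = _
    simp [List.getD_eq_getElem?_getD, List.getElem?_eq_getElem h1]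
  rw [h0]
  rcases le_total k (n+1) with hk | hk
  · exact ((itw_prefix hk).getElem h).symm
  · exact ((itw_prefix hk).getElem h1)

lemma w_insig (n : ℕ) : InSig (w n) := by
  rw [w_eq (k := n) (itw_length n)]
  exact itw_insig n _ (List.getElem_mem _)

/-- Prefixes of w. -/
def Wp (p : ℕ) : List ℕ := (List.range p).map w

lemma Wp_insig (p : ℕ) : ∀ a ∈ Wp p, InSig a := by
  intro a ha
  simp only [Wp, List.mem_map] at ha
  obtain ⟨n, _, rfl⟩ := ha
  exact w_insig n

lemma Wp_eq_of_prefix {x : List ℕ} {k : ℕ} (h : x <+: itw k) : Wp x.length = x := by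
  apply List.ext_getElem
  · simp [Wp]
  · intro n h1 h2
    have h3 : n < (itw k).length := lt_of_lt_of_le h2 h.length_le
    rw [h.getElem h2, ← w_eq h3]
    simp [Wp]

lemma Wp_prefix (p : ℕ) : Wp p <+: itw p := by
  have h : (itw p).take p <+: itw p := List.take_prefix _ _
  have h2 := Wp_eq_of_prefix h
  have h3 : ((itw p).take p).length = p := by
    have := itw_length p
    simp; omega
  rw [h3] at h2
  rw [h2]; exact h

lemma phi_Wp (p : ℕ) : phi (Wp p) = Wp (eta p) := by
  have h := phi_prefix (Wp_prefix p)
  rw [← itw_succ] at h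
  exact (Wp_eq_of_prefix h).symm

lemma Wp_succ (p : ℕ) : Wp (p + 1) = Wp p ++ [w p] := by
  simp [Wp, List.range_succ]

lemma eta_succ (p : ℕ) : eta (p + 1) = eta p + (phiLetter (w p)).length := by
  change (phi (Wp (p+1))).length = (phi (Wp p)).length + _
  rw [Wp_succ, phi_append]; simp [phi]

lemma phiLetter_length (n : ℕ) : (phiLetter n).length ≤ 2 := by
  unfold phiLetter; split <;> simp

lemma le_eta (p : ℕ) : p ≤ eta p := by
  have := phi_length_ge (Wp_insig p)
  change p ≤ (phi (Wp p)).length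
  simpa [Wp] using this

lemma par_le (x : ℕ) : par x ≤ x := Nat.findGreatest_le x

lemma eta_par_le (x : ℕ) : eta (par x) ≤ x := by
  have h0 : eta 0 ≤ x := by simp [eta, phi]
  exact Nat.findGreatest_spec (P := fun t => eta t ≤ x) (Nat.zero_le x) h0

lemma lt_eta_par_succ (x : ℕ) : x < eta (par x + 1) := by
  by_contra hc
  push Not at hc
  have h1 : par x + 1 ≤ x := (le_eta _).trans hc
  have := Nat.le_findGreatest (P := fun t => eta t ≤ x) h1 hc
  change par x + 1 ≤ par x at this
  omega

lemma par_mono {x y : ℕ} (h : x ≤ y) : par x ≤ par y :=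
  Nat.findGreatest_mono (fun _ ht => le_trans ht h) h

lemma par_iter_mono (i : ℕ) {x y : ℕ} (h : x ≤ y) : par^[i] x ≤ par^[i] y :=
  (show Monotone par from fun _ _ h => par_mono h).iterate i h

lemma psi_append (x y : List ℕ) : psi (x ++ y) = psi x + psi y := by
  ext j; fin_cases j <;> simp [psi]

lemma psi_phiLetter (a : ℕ) : psi (phiLetter a) = M.mulVec (psi [a]) := by
  by_cases h0 : a = 0
  · subst h0; decide
  by_cases h1 : a = 1
  · subst h1; decide
  by_cases h3 : a = 3
  · subst h3; decide
  by_cases h4 : a = 4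
  · subst h4; decide
  have e : phiLetter a = [] := by
    unfold phiLetter; split <;> first | rfl | (exfalso; omega)
  have e2 : psi [a] = 0 := by
    ext j; fin_cases j <;> simp [psi, List.count_singleton, h0, h1, h3, h4]
  rw [e, e2, Matrix.mulVec_zero]; ext j; fin_cases j <;> simp [psi]

lemma psi_phi (x : List ℕ) : psi (phi x) = M.mulVec (psi x) := by
  induction x with
  | nil => simp [phi]; decide
  | cons a x ih =>
    rw [phi_cons, psi_append, ih, psi_phiLetter, ← Matrix.mulVec_add, ← psi_append]; rfl

lemma sigma_key (p : ℕ) : ∃ e : Fin 4 → ℤ, (∀ j, e j = 0 ∨ e j = 1) ∧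
    sigmaW p = M.mulVec (sigmaW (par p)) + e := by
  have h1 := eta_par_le p
  have h2 := lt_eta_par_succ p
  rw [eta_succ] at h2
  have h3 := phiLetter_length (w (par p))
  have h4 : M.mulVec (sigmaW (par p)) = psi (Wp (eta (par p))) := by
    rw [← phi_Wp, psi_phi]; rfl
  rw [h4]
  change ∃ e : Fin 4 → ℤ, (∀ j, e j = 0 ∨ e j = 1) ∧ psi (Wp p) = _
  have h5 : p = eta (par p) ∨ p = eta (par p) + 1 := by omega
  rcases h5 with h5 | h5
  · exact ⟨0, by simp, by rw [← h5]; simp⟩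
  · refine ⟨psi [w (par p |> eta)], ?_, ?_⟩
    · intro j
      fin_cases j <;> simp [psi, List.count_singleton] <;> tauto
    · conv_lhs => rw [h5, Wp_succ, psi_append]

lemma Wp_factor {p q : ℕ} (h : p ≤ q) : Wp q = Wp p ++ factorW p q := by
  obtain ⟨k, rfl⟩ := Nat.exists_eq_add_of_le h
  simp only [Wp, factorW, ← List.map_append, Nat.add_sub_cancel_left, List.range_eq_range']
  congr 1
  have := List.range'_append_1 (s := 0) (m := p) (n := k)
  simpa using this.symm

lemma psi_factor {p q : ℕ} (h : p ≤ q) : psi (factorW p q) = sigmaW q - sigmaW p := by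
  change _ = psi (Wp q) - psi (Wp p)
  rw [Wp_factor h, psi_append]; simp

lemma len_sum {x : List ℕ} (h : ∀ a ∈ x, InSig a) :
    (x.length : ℤ) = psi x 0 + psi x 1 + psi x 2 + psi x 3 ∧
    (x.sum : ℤ) = psi x 1 + 3 * psi x 2 + 4 * psi x 3 := by
  induction x with
  | nil => simp [psi]
  | cons a x ih =>
    obtain ⟨i1, i2⟩ := ih (fun b hb => h b (by simp [hb]))
    rw [show a :: x = [a] ++ x from rfl, psi_append]
    rcases h a (by simp) with rfl | rfl | rfl | rfl <;>
      · simp [psi, List.count_singleton] at i1 i2 ⊢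
        constructor <;> linarith

lemma factor_insig (p q : ℕ) : ∀ a ∈ factorW p q, InSig a := by
  intro a ha
  simp only [factorW, List.mem_map] at ha
  obtain ⟨n, _, rfl⟩ := ha
  exact w_insig n

/-- Linear functional of the prefix Parikh vector. -/
noncomputable def Lf {K : Type*} [RCLike K] (c : Fin 4 → K) (p : ℕ) : K :=
  ∑ j, c j * ((sigmaW p j : ℤ) : K)

lemma Lf_step {K : Type*} [RCLike K] (c : Fin 4 → K) (mu : K)
    (h : Matrix.vecMul c (M.map (Int.cast : ℤ → K)) = mu • c) (p : ℕ) :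
    ‖Lf c p - mu * Lf c (par p)‖ ≤ ∑ j, ‖c j‖ := by
  obtain ⟨e, he, hs⟩ := sigma_key p
  have h1 : Lf c p - mu * Lf c (par p) = ∑ j, c j * ((e j : ℤ) : K) := by
    have g0 := congrFun h 0
    have g1 := congrFun h 1
    have g2 := congrFun h 2
    have g3 := congrFun h 3
    simp [Matrix.vecMul, dotProduct, Fin.sum_univ_four, M] at g0 g1 g2 g3
    unfold Lf
    rw [hs]
    simp [Matrix.mulVec, dotProduct, Fin.sum_univ_four, M]
    linear_combination (sigmaW (par p) 0 : K) * g0 + (sigmaW (par p) 1 : K) * g1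
      + (sigmaW (par p) 2 : K) * g2 + (sigmaW (par p) 3 : K) * g3
  rw [h1]
  refine (norm_sum_le _ _).trans (Finset.sum_le_sum fun j _ => ?_)
  rcases he j with hj | hj <;> simp [hj]

lemma Lf_bounded (c : Fin 4 → ℂ) (mu : ℂ) (hmu : ‖mu‖ < 1)
    (h : Matrix.vecMul c (M.map (Int.cast : ℤ → ℂ)) = mu • c) :
    ∃ B, ∀ p, ‖Lf c p‖ ≤ B := by
  refine ⟨(∑ j, ‖c j‖) / (1 - ‖mu‖), fun p => ?_⟩
  have hpos : 0 < 1 - ‖mu‖ := by linarith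
  induction p using Nat.strong_induction_on with
  | _ p ih =>
    have h1 := Lf_step c mu h p
    have h2 : ‖Lf c p‖ ≤ ‖mu‖ * ‖Lf c (par p)‖ + ∑ j, ‖c j‖ := by
      rw [← norm_mul]
      have := norm_sub_norm_le (Lf c p) (mu * Lf c (par p))
      linarith
    rw [le_div_iff₀ hpos]
    rcases (par_le p).eq_or_lt with hp | hp
    · rw [hp] at h2; linarith
    · have h3 := ih _ hp
      rw [le_div_iff₀ hpos] at h3
      nlinarith [norm_nonneg mu]

/-- The contracting complex eigenvalue. -/
lemma exists_mu : ∃ (s n : ℝ) (mu : ℂ), mu ^ 2 = s * mu - n ∧ ‖mu‖ < 1 ∧ mu.im ≠ 0 ∧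
    mu ^ 4 - mu ^ 3 - 2 * mu ^ 2 + 2 * mu - 1 = 0 ∧
    (0.39 ≤ n ∧ n ≤ 0.4) ∧ (0.8 ≤ s ∧ s ≤ 0.84) := by
  let S : ℝ → ℝ := fun n => n * (2 + n) / (n ^ 2 + 1)
  let f : ℝ → ℝ := fun n => n - 1 / n + S n * (1 - S n) + 2
  have hc : ContinuousOn f (Set.Icc 0.39 0.4) := by
    have hS : Continuous S := by
      apply Continuous.div (by fun_prop) (by fun_prop)
      intro x; positivity
    apply ContinuousOn.add _ continuousOn_const
    apply ContinuousOn.add _ (by fun_prop)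
    apply ContinuousOn.sub continuousOn_id
    apply ContinuousOn.div continuousOn_const continuousOn_id
    intro x hx; have := hx.1; simp; intro h; subst h; norm_num at this
  have h0 : (0:ℝ) ∈ Set.Icc (f 0.39) (f 0.4) := by
    constructor <;> norm_num [f, S]
  obtain ⟨n, ⟨hn1, hn2⟩, hf⟩ := intermediate_value_Icc (by norm_num) hc h0
  have hn0 : 0 < n := by linarith
  have hsn : S n * (n ^ 2 + 1) = n * (2 + n) := by
    simp only [S]; field_simp
  have hs1 : 0.8 ≤ S n := by
    simp only [S]; rw [le_div_iff₀ (by positivity)]; nlinarith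
  have hs2 : S n ≤ 0.84 := by
    simp only [S]; rw [div_le_iff₀ (by positivity)]; nlinarith
  have hf' : n ^ 2 - 1 + n * (S n * (1 - S n)) + 2 * n = 0 := by
    have : n * f n = 0 := by rw [hf, mul_zero]
    simp only [f] at this
    have e : n * (1 / n) = 1 := by field_simp
    linear_combination this + e
  generalize S n = s at *
  have hD : 0 < n - s ^ 2 / 4 := by nlinarith
  set y := Real.sqrt (n - s ^ 2 / 4) with hy
  have hy2 : y ^ 2 = n - s ^ 2 / 4 := Real.sq_sqrt hD.le
  have hypos : 0 < y := Real.sqrt_pos.mpr hD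
  have hmu : (⟨s / 2, y⟩ : ℂ) ^ 2 = s * (⟨s / 2, y⟩ : ℂ) - n := by
    apply Complex.ext <;> simp [pow_two] <;> nlinarith
  refine ⟨s, n, ⟨s / 2, y⟩, hmu, ?_, hypos.ne', ?_, ⟨hn1, hn2⟩, hs1, hs2⟩
  · have : ‖(⟨s / 2, y⟩ : ℂ)‖ ^ 2 = n := by
      rw [Complex.sq_norm, Complex.normSq_mk]; nlinarith
    nlinarith [norm_nonneg (⟨s / 2, y⟩ : ℂ)]
  · generalize (⟨s / 2, y⟩ : ℂ) = m at hmu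
    have h1 : (s : ℂ) * (n ^ 2 + 1) = n * (2 + n) := by exact_mod_cast hsn
    have h2 : (n : ℂ) ^ 2 - 1 + n * (s * (1 - s)) + 2 * n = 0 := by exact_mod_cast hf'
    have hnC : (n : ℂ) ≠ 0 := by exact_mod_cast hn0.ne'
    apply mul_left_cancel₀ hnC
    rw [mul_zero]
    have key : (n : ℂ) * (m ^ 4 - m ^ 3 - 2 * m ^ 2 + 2 * m - 1)
       = (m ^ 2 - s * m + n) * (n * m ^ 2 - n * (1 - s) * m - 1) := by
      linear_combination (-m ^ 2) * h2 - m * h1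
    rw [key, hmu]; ring

lemma initial_bound : ∃ B : ℝ, ∀ p q p' q' : ℕ, p ≤ q → p' ≤ q' →
      (factorW p q).length = (factorW p' q').length →
      (factorW p q).sum = (factorW p' q').sum →
      ∀ j, |((psi (factorW p q) j - psi (factorW p' q') j : ℤ) : ℝ)| ≤ B := by
  obtain ⟨s, n, mu, hmu, hnorm, him, hroot, ⟨hn1, hn2⟩, hs1, hs2⟩ := exists_mu
  let c : Fin 4 → ℂ := ![1, mu ^ 2 - mu, mu - 1, mu ^ 3 - mu ^ 2 - mu + 1]
  have hc : Matrix.vecMul c (M.map (Int.cast : ℤ → ℂ)) = mu • c := by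
    ext j
    fin_cases j <;> simp [Matrix.vecMul, dotProduct, Fin.sum_univ_four, M, c]
    · ring
    · ring
    · linear_combination -hroot
  obtain ⟨B, hB⟩ := Lf_bounded c mu hnorm hc
  let α : ℂ := 1 + 4 * mu - 3 * mu ^ 2
  let β : ℂ := 4 + 3 * mu - 5 * mu ^ 2 + mu ^ 3
  have hα : α = ((1 + 3 * n : ℝ) : ℂ) + ((4 - 3 * s : ℝ) : ℂ) * mu := by
    simp only [α]; push_cast; linear_combination (-3) * hmu
  have hβ : β = ((4 + 5 * n - s * n : ℝ) : ℂ) + ((3 - 5 * s + s ^ 2 - n : ℝ) : ℂ) * mu := by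
    simp only [β]; push_cast; linear_combination (-5 + mu + s) * hmu
  set D := (α * (starRingEnd ℂ) β).im with hDdef
  have hD : D = ((4 - 3 * s) * (4 + 5 * n - s * n) -
      (1 + 3 * n) * (3 - 5 * s + s ^ 2 - n)) * mu.im := by
    rw [hDdef, hα, hβ]
    simp only [Complex.mul_im, Complex.add_re, Complex.add_im, Complex.conj_re, Complex.conj_im,
      Complex.mul_re, Complex.ofReal_re, Complex.ofReal_im]
    ring
  have hD0 : D ≠ 0 := by
    rw [hD]
    refine mul_ne_zero ?_ him
    have a1 : 1 ≤ 4 - 3 * s := by linarith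
    have a2 : 1 ≤ 4 + 5 * n - s * n := by nlinarith
    have a3 : 3 - 5 * s + s ^ 2 - n ≤ 0 := by nlinarith
    have : 0 < (4 - 3 * s) * (4 + 5 * n - s * n) -
      (1 + 3 * n) * (3 - 5 * s + s ^ 2 - n) := by nlinarith
    exact this.ne'
  have hDp : 0 < |D| := abs_pos.mpr hD0
  let E := 4 * B * (‖α‖ + ‖β‖) / |D|
  refine ⟨10 * E, ?_⟩
  intro p q p' q' hpq hpq' hlen hsum
  obtain ⟨l1, m1⟩ := len_sum (factor_insig p q)
  obtain ⟨l2, m2⟩ := len_sum (factor_insig p' q')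
  rw [hlen, l2] at l1
  rw [hsum, m2] at m1
  have hz : ∑ j, c j * ((psi (factorW p q) j - psi (factorW p' q') j : ℤ) : ℂ)
      = (Lf c q - Lf c p) - (Lf c q' - Lf c p') := by
    rw [psi_factor hpq, psi_factor hpq']
    simp only [Lf, Fin.sum_univ_four, Pi.sub_apply]
    push_cast; ring
  have hzn : ‖∑ j, c j * ((psi (factorW p q) j - psi (factorW p' q') j : ℤ) : ℂ)‖ ≤ 4 * B := by
    rw [hz]
    have := norm_sub_le (Lf c q - Lf c p) (Lf c q' - Lf c p')
    have := norm_sub_le (Lf c q) (Lf c p)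
    have := norm_sub_le (Lf c q') (Lf c p')
    linarith [hB p, hB q, hB p', hB q']
  generalize psi (factorW p q) = x at *
  generalize psi (factorW p' q') = x' at *
  set a : ℤ := x 2 - x' 2 with ha
  set b : ℤ := x 3 - x' 3 with hb
  have e1 : x 1 - x' 1 = -3 * a - 4 * b := by omega
  have e0 : x 0 - x' 0 = 2 * a + 3 * b := by omega
  have hzz : ∑ j, c j * ((x j - x' j : ℤ) : ℂ) = ((a : ℝ) : ℂ) * α + ((b : ℝ) : ℂ) * β := by
    rw [Fin.sum_univ_four, e0, e1, ← ha, ← hb]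
    simp [c, α, β]; ring
  rw [hzz] at hzn
  have ia : (a : ℝ) * D = ((((a : ℝ) : ℂ) * α + ((b : ℝ) : ℂ) * β) * (starRingEnd ℂ) β).im := by
    rw [hDdef]
    simp only [Complex.mul_im, Complex.add_re, Complex.add_im, Complex.conj_re, Complex.conj_im,
      Complex.mul_re, Complex.ofReal_re, Complex.ofReal_im]
    ring
  have ib : (b : ℝ) * D = -((((a : ℝ) : ℂ) * α + ((b : ℝ) : ℂ) * β) * (starRingEnd ℂ) α).im := by
    rw [hDdef]
    simp only [Complex.mul_im, Complex.add_re, Complex.add_im, Complex.conj_re, Complex.conj_im,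
      Complex.mul_re, Complex.ofReal_re, Complex.ofReal_im]
    ring
  have hB0 : 0 ≤ 4 * B := (norm_nonneg _).trans hzn
  have ba : |(a : ℝ)| ≤ E := by
    simp only [E]; rw [le_div_iff₀ hDp, ← abs_mul, ia]
    refine (Complex.abs_im_le_norm _).trans ?_
    rw [norm_mul, RCLike.norm_conj]
    exact mul_le_mul hzn (by linarith [norm_nonneg α]) (norm_nonneg _) hB0
  have bb : |(b : ℝ)| ≤ E := by
    simp only [E]; rw [le_div_iff₀ hDp, ← abs_mul, ib, abs_neg]
    refine (Complex.abs_im_le_norm _).trans ?_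
    rw [norm_mul, RCLike.norm_conj]
    exact mul_le_mul hzn (by linarith [norm_nonneg β]) (norm_nonneg _) hB0
  rw [abs_le] at ba bb
  intro j
  rw [abs_le]
  fin_cases j
  · simp only [Fin.zero_eta, e0]; push_cast; constructor <;> linarith
  · simp only [Fin.mk_one, e1]; push_cast; constructor <;> linarith
  · change -(10 * E) ≤ ((a : ℤ) : ℝ) ∧ ((a : ℤ) : ℝ) ≤ _; constructor <;> linarith
  · change -(10 * E) ≤ ((b : ℤ) : ℝ) ∧ ((b : ℤ) : ℝ) ≤ _; constructor <;> linarith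

/-- If `λ` is a real eigenvalue of `M` with `|λ| > 1` and `u` a nonzero
left real eigenvector for `λ`, then there is a constant `C` bounding
`|u·(ψ(bᵢ) − ψ(cᵢ))|` for all ancestral blocks of any two factors of `w` with the same
length and sum. -/
theorem bounded_real_eigencoordinate (lam : ℝ) (u : Fin 4 → ℝ) (hlam : 1 < |lam|)
    (hu : u ≠ 0) (heig : Matrix.vecMul u (M.map (Int.cast : ℤ → ℝ)) = lam • u) :
    ∃ C : ℝ, ∀ p q p' q' : ℕ, p ≤ q → p' ≤ q' →
      (factorW p q).length = (factorW p' q').length →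
      (factorW p q).sum = (factorW p' q').sum →
      ∀ i : ℕ,
        |∑ j, u j * ((psi (factorW (par^[i] p) (par^[i] q)) j -
            psi (factorW (par^[i] p') (par^[i] q')) j : ℤ) : ℝ)| ≤ C := by
  obtain ⟨B, hB⟩ := initial_bound
  set U := ∑ j, ‖u j‖ with hU
  have hU0 : 0 ≤ U := Finset.sum_nonneg fun j _ => norm_nonneg _
  have hl : 0 < |lam| - 1 := by linarith
  refine ⟨max (U * B) (4 * U / (|lam| - 1)), ?_⟩
  intro p q p' q' hpq hpq' hlen hsum i
  have hF : ∀ i, ∑ j, u j * ((psi (factorW (par^[i] p) (par^[i] q)) j -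
      psi (factorW (par^[i] p') (par^[i] q')) j : ℤ) : ℝ) =
      (Lf u (par^[i] q) - Lf u (par^[i] p)) - (Lf u (par^[i] q') - Lf u (par^[i] p')) := by
    intro i
    rw [psi_factor (par_iter_mono i hpq), psi_factor (par_iter_mono i hpq')]
    simp only [Lf, Fin.sum_univ_four, Pi.sub_apply]
    push_cast; ring
  induction i with
  | zero =>
    refine le_trans ?_ (le_max_left _ _)
    refine (Finset.abs_sum_le_sum_abs _ _).trans ?_
    rw [hU, Finset.sum_mul]
    refine Finset.sum_le_sum fun j _ => ?_
    rw [abs_mul]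
    exact mul_le_mul_of_nonneg_left (hB p q p' q' hpq hpq' hlen hsum j) (abs_nonneg _)
  | succ i ih =>
    rw [hF] at ih ⊢
    simp only [Function.iterate_succ_apply']
    have s1 := Lf_step u lam heig (par^[i] p)
    have s2 := Lf_step u lam heig (par^[i] q)
    have s3 := Lf_step u lam heig (par^[i] p')
    have s4 := Lf_step u lam heig (par^[i] q')
    rw [← hU, Real.norm_eq_abs, abs_le] at s1 s2 s3 s4
    set X := (Lf u (par^[i] q) - Lf u (par^[i] p)) - (Lf u (par^[i] q') - Lf u (par^[i] p'))
    set Y := (Lf u (par (par^[i] q)) - Lf u (par (par^[i] p))) -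
      (Lf u (par (par^[i] q')) - Lf u (par (par^[i] p'))) with hY
    set C := max (U * B) (4 * U / (|lam| - 1)) with hC
    have hC2 : 4 * U ≤ C * (|lam| - 1) := by
      rw [← div_le_iff₀ hl]; exact le_max_right _ _
    have hXY : |X - lam * Y| ≤ 4 * U := by
      rw [abs_le]; constructor <;> simp only [X, Y] <;> linarith
    have h5 : |lam| * |Y| ≤ |X| + 4 * U := by
      rw [← abs_mul]
      have := abs_sub_abs_le_abs_sub (lam * Y) X
      rw [abs_sub_comm (lam * Y) X] at this
      linarith
    have h6 : |lam| * |Y| ≤ |lam| * C := by linarith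
    exact le_of_mul_le_mul_left h6 (by linarith)
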